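/- arXiv:0707.3310 — 2 statements merged into one kernel-verified Lean document; each statement's English description precedes it below -/
import Mathlib

section
/- Let W be a Coxeter group realized geometrically via an E-GCM A as σ : W → GL(V) with root system Φ = {w.α_i : w ∈ W, i ∈ I} and Φ⁺, Φ⁻ the positive and negative roots. If α and β are roots in the same W-orbit, then there is a bijection between 𝔖(α) := {Kα : K ∈ ℝ} ∩ Φ⁺ and 𝔖(β) := {Kβ : K ∈ ℝ} ∩ Φ⁺. -/
open Real

variable {n : ℕ}

/-- E-generalized Cartan matrix: diagonal entries 2, off-diagonal entries nonpositive,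
`a_{ij} = 0 ↔ a_{ji} = 0`, and each off-diagonal product is `≥ 4` or of the form
`4cos²(π/k)` for an integer `k ≥ 2`. -/
def IsEGCM (A : Fin n → Fin n → ℝ) : Prop :=
  (∀ i, A i i = 2) ∧
  (∀ i j, i ≠ j → A i j ≤ 0) ∧
  (∀ i j, A i j = 0 → A j i = 0) ∧
  (∀ i j, i ≠ j → A i j * A j i ≥ 4 ∨
    ∃ k : ℕ, 2 ≤ k ∧ A i j * A j i = 4 * (Real.cos (Real.pi / k)) ^ 2)

/-- The Coxeter exponent `m_{ij}` (with `0` encoding `∞`). -/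
noncomputable def mval (A : Fin n → Fin n → ℝ) (i j : Fin n) : ℕ :=
  open scoped Classical in
  if h : ∃ k : ℕ, 2 ≤ k ∧ A i j * A j i = 4 * (Real.cos (Real.pi / k)) ^ 2
  then h.choose else 0

/-- The generating "reflection" `S_i(v) = v - 2B(α_i, v)α_i` where `B(α_i, α_j) = a_{ij}/2`
and the simple roots `α_i` are the standard basis vectors of `Fin n → ℝ`. -/
noncomputable def S (A : Fin n → Fin n → ℝ) (i : Fin n) : Function.End (Fin n → ℝ) :=
  fun v => v - (∑ j, A i j * v j) • (Pi.single i (1 : ℝ) : Fin n → ℝ)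

/-- The representing group `σ(W)`, as the monoid generated by the reflections `S_i`
(each `S_i` is an involution, so this is a group of transformations). -/
noncomputable def Wgrp (A : Fin n → Fin n → ℝ) : Submonoid (Function.End (Fin n → ℝ)) :=
  Submonoid.closure (Set.range (S A))

/-- The simple root `α_i`. -/
noncomputable def simple (i : Fin n) : Fin n → ℝ := Pi.single i 1

/-- The root system `Φ = {w.α_i}`. -/
noncomputable def Phi (A : Fin n → Fin n → ℝ) : Set (Fin n → ℝ) :=
  {v | ∃ w ∈ Wgrp A, ∃ i, w (simple i) = v}

/-- Positive roots. -/
noncomputable def PhiPos (A : Fin n → Fin n → ℝ) : Set (Fin n → ℝ) :=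
  {v | v ∈ Phi A ∧ ∀ j, 0 ≤ v j}

/-- Negative roots. -/
noncomputable def PhiNeg (A : Fin n → Fin n → ℝ) : Set (Fin n → ℝ) :=
  {v | v ∈ Phi A ∧ ∀ j, v j ≤ 0}

/-- `𝔖(α)`: the positive roots which are real scalar multiples of `α`. -/
noncomputable def Sfrak (A : Fin n → Fin n → ℝ) (α : Fin n → ℝ) : Set (Fin n → ℝ) :=
  {β | β ∈ PhiPos A ∧ ∃ K : ℝ, β = K • α}

/-- `N(w)`: the positive roots sent to negative roots by `w`. -/
noncomputable def Nset (A : Fin n → Fin n → ℝ) (w : Function.End (Fin n → ℝ)) :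
    Set (Fin n → ℝ) :=
  {α | α ∈ PhiPos A ∧ w α ∈ PhiNeg A}

/-- The Coxeter length of `w`: the least length of a word in the generators `S_i`
representing `w`. -/
noncomputable def len (A : Fin n → Fin n → ℝ) (w : Function.End (Fin n → ℝ)) : ℕ :=
  sInf {p | ∃ l : List (Fin n), l.length = p ∧ (l.map (S A)).prod = w}

/-- `γ_i` and `γ_j` are odd neighbors: `m_{ij}` is odd (in particular finite). -/
def OddNbr (A : Fin n → Fin n → ℝ) (i j : Fin n) : Prop := i ≠ j ∧ Odd (mval A i j)

/-- The scalar `K_{ji} = -a_{ji}/(2cos(π/m_{ij}))`. -/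
noncomputable def Kval (A : Fin n → Fin n → ℝ) (j i : Fin n) : ℝ :=
  -(A j i) / (2 * Real.cos (Real.pi / (mval A j i)))

/-- The scalar `Π_𝒫` attached to an ON-path `𝒫`: the product of the `K`'s along its steps. -/
noncomputable def pathProd (A : Fin n → Fin n → ℝ) : List (Fin n) → ℝ
  | [] => 1
  | [_] => 1
  | i :: j :: t => Kval A j i * pathProd A (j :: t)

/-- An ON-path: consecutive nodes are odd neighbors. -/
def IsONPath (A : Fin n → Fin n → ℝ) (l : List (Fin n)) : Prop := l.Chain' (OddNbr A)

/-- An ON-cycle: an ON-path of nonzero length whose start and end nodes coincide. -/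
def IsONCycle (A : Fin n → Fin n → ℝ) (l : List (Fin n)) : Prop :=
  IsONPath A l ∧ 2 ≤ l.length ∧ l.head? = l.getLast?

/-- `(Γ, A)` is unital ON-cyclic: `Π_𝒞 = 1` for every ON-cycle `𝒞`. -/
def UnitalONCyclic (A : Fin n → Fin n → ℝ) : Prop :=
  ∀ l : List (Fin n), IsONCycle A l → pathProd A l = 1

open CoxeterSystem (alternatingWord)

section Words

lemma end_mul_apply {X : Type*} (f g : Function.End X) (x : X) : (f * g) x = f (g x) := rfl

variable (A : Fin n → Fin n → ℝ)

/-- The transformation represented by a word in the generators. -/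
noncomputable def wordMap (l : List (Fin n)) : Function.End (Fin n → ℝ) := (l.map (S A)).prod

lemma wordMap_nil : wordMap A [] = 1 := rfl

lemma wordMap_append (l l' : List (Fin n)) :
    wordMap A (l ++ l') = wordMap A l * wordMap A l' := by
  simp [wordMap]

lemma wordMap_singleton (i : Fin n) : wordMap A [i] = S A i := by
  simp [wordMap]

lemma wordMap_cons (i : Fin n) (l : List (Fin n)) :
    wordMap A (i :: l) = S A i * wordMap A l := by
  simp [wordMap]

lemma wordMap_mem (l : List (Fin n)) : wordMap A l ∈ Wgrp A := by
  refine Submonoid.list_prod_mem _ fun x hx => ?_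
  obtain ⟨i, -, rfl⟩ := List.mem_map.1 hx
  exact Submonoid.subset_closure ⟨i, rfl⟩

variable {A}

lemma exists_wordMap_eq {w : Function.End (Fin n → ℝ)} (hw : w ∈ Wgrp A) :
    ∃ l, wordMap A l = w := by
  induction hw using Submonoid.closure_induction with
  | mem x hx =>
    obtain ⟨i, rfl⟩ := hx
    exact ⟨[i], wordMap_singleton A i⟩
  | one => exact ⟨[], rfl⟩
  | mul x y _ _ hx hy =>
    obtain ⟨l, rfl⟩ := hx
    obtain ⟨l', rfl⟩ := hy
    exact ⟨l ++ l', wordMap_append A l l'⟩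

lemma len_wordMap_le (l : List (Fin n)) : len A (wordMap A l) ≤ l.length :=
  Nat.sInf_le ⟨l, rfl, rfl⟩

lemma exists_reduced {w : Function.End (Fin n → ℝ)} (hw : w ∈ Wgrp A) :
    ∃ l, wordMap A l = w ∧ l.length = len A w := by
  obtain ⟨l, hl⟩ := exists_wordMap_eq hw
  obtain ⟨l', h, h'⟩ := Nat.sInf_mem
    (s := {p | ∃ l : List (Fin n), l.length = p ∧ (l.map (S A)).prod = w}) ⟨_, l, rfl, hl⟩
  exact ⟨l', h', h⟩

lemma len_mul_wordMap_le {v : Function.End (Fin n → ℝ)} (hv : v ∈ Wgrp A) (l : List (Fin n)) :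
    len A (v * wordMap A l) ≤ len A v + l.length := by
  obtain ⟨l', rfl, h⟩ := exists_reduced hv
  rw [← h, ← wordMap_append, ← List.length_append]
  exact len_wordMap_le _

lemma isLinearMap_S (i : Fin n) : IsLinearMap ℝ (S A i) := by
  constructor
  · intro x y
    simp only [S, Pi.add_apply, mul_add, Finset.sum_add_distrib, add_smul]
    abel
  · intro c x
    simp only [S, Pi.smul_apply, smul_eq_mul, smul_sub, smul_smul, Finset.mul_sum]
    simp only [mul_left_comm]

lemma isLinearMap_of_mem {w : Function.End (Fin n → ℝ)} (hw : w ∈ Wgrp A) :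
    IsLinearMap ℝ w := by
  induction hw using Submonoid.closure_induction with
  | mem x hx =>
    obtain ⟨i, rfl⟩ := hx
    exact isLinearMap_S i
  | one => exact ⟨fun _ _ => rfl, fun _ _ => rfl⟩
  | mul x y _ _ hx hy =>
    exact ⟨fun a b => by simp [end_mul_apply, hx.map_add, hy.map_add],
      fun c a => by simp [end_mul_apply, hx.map_smul, hy.map_smul]⟩

lemma S_simple (i j : Fin n) : S A i (simple j) = simple j - A i j • simple i := by
  simp [S, simple, Pi.single_apply]

lemma S_simple_self (hA : IsEGCM A) (i : Fin n) : S A i (simple i) = -simple i := by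
  rw [S_simple, hA.1, two_smul]
  abel

lemma S_mul_self (hA : IsEGCM A) (i : Fin n) : S A i * S A i = 1 := by
  funext v
  change S A i (v - (∑ j, A i j * v j) • simple i) = v
  rw [(isLinearMap_S i).map_sub, (isLinearMap_S i).map_smul, S_simple_self hA]
  change v - (∑ j, A i j * v j) • simple i - (∑ j, A i j * v j) • -simple i = v
  simp

lemma exists_inverse (hA : IsEGCM A) {w : Function.End (Fin n → ℝ)} (hw : w ∈ Wgrp A) :
    ∃ w' ∈ Wgrp A, w' * w = 1 := by
  induction hw using Submonoid.closure_induction with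
  | mem x hx =>
    obtain ⟨i, rfl⟩ := hx
    exact ⟨_, Submonoid.subset_closure ⟨i, rfl⟩, S_mul_self hA i⟩
  | one => exact ⟨1, one_mem _, one_mul 1⟩
  | mul x y _ _ hx hy =>
    obtain ⟨x', hx', hxx⟩ := hx
    obtain ⟨y', hy', hyy⟩ := hy
    exact ⟨y' * x', mul_mem hy' hx', by rw [mul_assoc, ← mul_assoc x', hxx, one_mul, hyy]⟩

end Words

section Alternating

lemma exists_append_alternatingWord {B : Type*} (s t : B) (k r : ℕ) :
    ∃ q : List B, q.length = r ∧ alternatingWord s t (r + k) = q ++ alternatingWord s t k := by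
  induction r with
  | zero => exact ⟨[], rfl, by simp⟩
  | succ r ih =>
    obtain ⟨q, hq, h⟩ := ih
    refine ⟨(if Even (r + k) then t else s) :: q, by simp [hq], ?_⟩
    rw [Nat.add_right_comm, CoxeterSystem.alternatingWord_succ', h, List.cons_append]

lemma eq_alternatingWord {B : Type*} (p : List B) : ∀ (s t : B), (∀ x ∈ p, x = s ∨ x = t) →
    (∀ a b i, p ≠ a ++ i :: i :: b) → (∀ q, p ≠ q ++ [s]) →
    p = alternatingWord s t p.length := by
  induction p using List.reverseRecOn with
  | nil => intros; rfl
  | append_singleton p x ih =>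
    intro s t hmem hrep hlast
    have hx : x = t := (hmem x (by simp)).resolve_left fun h => hlast p (by rw [h])
    subst hx
    have := ih x s (fun y hy => (hmem y (by simp [hy])).symm)
      (fun a b i h => hrep a (b ++ [x]) i (by simp [h]))
      (fun q h => hrep q [] x (by simp [h]))
    rw [List.length_append, List.length_singleton, alternatingWord, ← this, List.concat_eq_append]

end Alternating

section RankTwo

/-- The values at `C` of the Chebyshev polynomials of the second kind, shifted by one. -/
def chebU (C : ℝ) : ℕ → ℝ
  | 0 => 0
  | 1 => 1
  | q + 2 => 2 * C * chebU C (q + 1) - chebU C q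

lemma chebU_cos_mul_sin (θ : ℝ) : ∀ q : ℕ, chebU (cos θ) q * sin θ = sin (q * θ)
  | 0 => by simp [chebU]
  | 1 => by simp [chebU]
  | q + 2 => by
    have h1 := chebU_cos_mul_sin θ (q + 1)
    have h0 := chebU_cos_mul_sin θ q
    rw [chebU, sub_mul, mul_assoc, h1, h0]
    have e1 : ((q + 1 : ℕ) : ℝ) * θ = q * θ + θ := by push_cast; ring
    have e2 : ((q + 2 : ℕ) : ℝ) * θ = q * θ + θ + θ := by push_cast; ring
    rw [e1, e2, sin_add (q * θ + θ), sin_add, cos_add]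
    linear_combination sin (q * θ) * (sin_sq_add_cos_sq θ)

lemma chebU_nonneg_of_one_le {C : ℝ} (hC : 1 ≤ C) (q : ℕ) : 0 ≤ chebU C q := by
  suffices h : 0 ≤ chebU C q ∧ chebU C q ≤ chebU C (q + 1) from h.1
  induction q with
  | zero => simp [chebU]
  | succ q ih =>
    refine ⟨ih.1.trans ih.2, ?_⟩
    rw [chebU]
    nlinarith [ih.1, ih.2]

lemma sin_pi_div_pos {k : ℕ} (hk : 2 ≤ k) : 0 < sin (π / k) := by
  have hk' : (2 : ℝ) ≤ k := by exact_mod_cast hk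
  apply sin_pos_of_pos_of_lt_pi (by positivity)
  rw [div_lt_iff₀ (by positivity)]
  nlinarith [pi_pos]

lemma cos_pi_div_nonneg {k : ℕ} (hk : 2 ≤ k) : 0 ≤ cos (π / k) := by
  have hk' : (2 : ℝ) ≤ k := by exact_mod_cast hk
  apply cos_nonneg_of_neg_pi_div_two_le_of_le
  · have : 0 < π / k := by positivity
    linarith [pi_pos]
  · gcongr

lemma chebU_cos_pi_div_nonneg {k : ℕ} (hk : 2 ≤ k) {q : ℕ} (hq : q ≤ k) :
    0 ≤ chebU (cos (π / k)) q := by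
  have hs := sin_pi_div_pos hk
  refine nonneg_of_mul_nonneg_left ?_ hs
  rw [chebU_cos_mul_sin]
  have hk' : (0 : ℝ) < k := by positivity
  have hq' : (q : ℝ) ≤ k := by exact_mod_cast hq
  apply sin_nonneg_of_nonneg_of_le_pi (by positivity)
  rw [← mul_div_assoc, div_le_iff₀ hk', mul_comm π]
  gcongr

lemma chebU_cos_pi_div_self {k : ℕ} (hk : 2 ≤ k) : chebU (cos (π / k)) k = 0 := by
  refine (mul_eq_zero.1 ?_).resolve_right (sin_pi_div_pos hk).ne'
  rw [chebU_cos_mul_sin, mul_div_cancel₀ _ (by positivity), sin_pi]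

lemma chebU_cos_pi_div_succ {k : ℕ} (hk : 2 ≤ k) : chebU (cos (π / k)) (k + 1) = -1 := by
  refine mul_right_cancel₀ (sin_pi_div_pos hk).ne' ?_
  rw [chebU_cos_mul_sin, Nat.cast_succ, add_mul, mul_div_cancel₀ _ (by positivity), add_comm,
    one_mul, sin_add_pi, neg_one_mul]

variable {A : Fin n → Fin n → ℝ}

lemma exists_scaling (hA : IsEGCM A) {s t : Fin n} (hst : s ≠ t) {C : ℝ} (hC : 0 ≤ C)
    (h : A s t * A t s = 4 * C ^ 2) :
    ∃ ρ : ℝ, 0 < ρ ∧ -(A s t * ρ) = 2 * C ∧ -A t s = 2 * C * ρ := by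
  by_cases h0 : A s t = 0
  · have hC0 : C = 0 := by simpa [h0] using h
    exact ⟨1, one_pos, by simp [h0, hC0], by simp [hA.2.2.1 s t h0, hC0]⟩
  · have ha : A s t < 0 := lt_of_le_of_ne (hA.2.1 s t hst) h0
    have hb : A t s < 0 :=
      lt_of_le_of_ne (hA.2.1 t s hst.symm) fun hb => h0 (hA.2.2.1 t s hb)
    have hC' : 0 < C := by
      refine lt_of_le_of_ne hC fun h' => ?_
      rw [← h'] at h
      nlinarith [mul_pos_of_neg_of_neg ha hb]
    refine ⟨-(2 * C) / A s t, div_pos_of_neg_of_neg (by linarith) ha, by field_simp, ?_⟩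
    field_simp
    linarith

lemma wordMap_alternatingWord_simple (hA : IsEGCM A) {s t : Fin n} {C ρ : ℝ}
    (h1 : -(A s t * ρ) = 2 * C) (h2 : -A t s = 2 * C * ρ) (q : ℕ) :
    wordMap A (alternatingWord s t q) (simple s) =
      if Even q then chebU C (q + 1) • simple s + (ρ * chebU C q) • simple t
      else chebU C q • simple s + (ρ * chebU C (q + 1)) • simple t := by
  induction q with
  | zero => simp [chebU, alternatingWord, wordMap_nil, Function.End.one_def]
  | succ q ih =>
    rw [CoxeterSystem.alternatingWord_succ', wordMap_cons, end_mul_apply, ih]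
    by_cases hq : Even q
    · have hq' : ¬ Even (q + 1) := by simpa [Nat.even_add_one] using hq
      simp only [if_pos hq, if_neg hq', (isLinearMap_S t).map_add, (isLinearMap_S t).map_smul,
        S_simple_self hA, S_simple t s, chebU]
      linear_combination (norm := module) (chebU C (q + 1) * h2) • simple t
    · have hq' : Even (q + 1) := by simpa [Nat.even_add_one] using hq
      simp only [if_neg hq, if_pos hq', (isLinearMap_S s).map_add, (isLinearMap_S s).map_smul,
        S_simple_self hA, S_simple s t, chebU]
      linear_combination (norm := module) (chebU C (q + 1) * h1) • simple s

lemma wordMap_fixed (l : List (Fin n)) {v : Fin n → ℝ} (h : ∀ i ∈ l, ∑ j, A i j * v j = 0) :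
    wordMap A l v = v := by
  induction l with
  | nil => rfl
  | cons i l ih =>
    rw [wordMap_cons, end_mul_apply,
      ih fun j hj => h j (List.mem_cons_of_mem _ hj)]
    simp [S, h i (by simp)]

lemma mem_alternatingWord {B : Type*} {q : ℕ} : ∀ {s t x : B}, x ∈ alternatingWord s t q →
    x = s ∨ x = t := by
  induction q with
  | zero => simp [alternatingWord]
  | succ q ih =>
    intro s t x hx
    rw [alternatingWord, List.concat_eq_append, List.mem_append, List.mem_singleton] at hx
    exact hx.elim (fun h => (ih h).symm) Or.inr

lemma braid_simple (hA : IsEGCM A) {s t : Fin n} (hst : s ≠ t) {k : ℕ} (hk : 2 ≤ k)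
    (h : A s t * A t s = 4 * cos (π / k) ^ 2) :
    wordMap A (alternatingWord s t k) (simple s) =
      wordMap A (alternatingWord t s k) (simple s) := by
  obtain ⟨ρ, -, h1, h2⟩ := exists_scaling hA hst (cos_pi_div_nonneg hk) h
  obtain ⟨m, rfl⟩ : ∃ m, k = m + 1 := ⟨k - 1, by omega⟩
  have e0 := chebU_cos_pi_div_self hk
  have e1 := chebU_cos_pi_div_succ hk
  have e2 : chebU (cos (π / (m + 1 : ℕ))) m = 1 := by
    rw [chebU, e0] at e1
    linarith
  conv_rhs => rw [alternatingWord, List.concat_eq_append, wordMap_append, wordMap_singleton,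
    end_mul_apply, S_simple_self hA,
    (isLinearMap_of_mem (wordMap_mem A _)).map_neg]
  rw [wordMap_alternatingWord_simple hA h1 h2, wordMap_alternatingWord_simple hA h1 h2, e0, e1, e2]
  by_cases hm : Even m
  · have hm' : ¬ Even (m + 1) := by simpa [Nat.even_add_one] using hm
    simp [hm, hm']
  · have hm' : Even (m + 1) := by simpa [Nat.even_add_one] using hm
    simp [hm, hm']

lemma braid (hA : IsEGCM A) {s t : Fin n} (hst : s ≠ t) {k : ℕ} (hk : 2 ≤ k)
    (h : A s t * A t s = 4 * cos (π / k) ^ 2) :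
    wordMap A (alternatingWord s t k) = wordMap A (alternatingWord t s k) := by
  have hd : 4 - A s t * A t s ≠ 0 := by
    have := sin_pi_div_pos hk
    have h' := sin_sq_add_cos_sq (π / k)
    rw [h]
    nlinarith
  funext v
  set f := ∑ j, A s j * v j with hf
  set g := ∑ j, A t j * v j with hg
  set x := (2 * f - A s t * g) / (4 - A s t * A t s) with hx
  set y := (2 * g - A t s * f) / (4 - A s t * A t s) with hy
  set z := v - (x • simple s + y • simple t) with hz
  have pair (i : Fin n) : ∑ j, A i j * z j = ∑ j, A i j * v j - (x * A i s + y * A i t) := by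
    simp [hz, simple, Pi.single_apply, mul_sub, mul_add, Finset.sum_add_distrib, mul_comm]
  have hs : ∑ j, A s j * z j = 0 := by
    rw [pair, hA.1, ← hf, hx, hy]
    field_simp
    ring
  have ht : ∑ j, A t j * z j = 0 := by
    rw [pair, hA.1, ← hg, hx, hy]
    field_simp
    ring
  have hv : v = x • simple s + y • simple t + z := by rw [hz]; abel
  have fixed (i i' : Fin n) (hi : ∑ j, A i j * z j = 0) (hi' : ∑ j, A i' j * z j = 0) :
      wordMap A (alternatingWord i i' k) z = z := by
    refine wordMap_fixed _ fun r hr => ?_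
    rcases mem_alternatingWord hr with rfl | rfl <;> assumption
  have h1 := isLinearMap_of_mem (wordMap_mem A (alternatingWord s t k))
  have h2 := isLinearMap_of_mem (wordMap_mem A (alternatingWord t s k))
  rw [hv, h1.map_add, h1.map_add, h1.map_smul, h1.map_smul, h2.map_add, h2.map_add, h2.map_smul,
    h2.map_smul, fixed s t hs ht, fixed t s ht hs, braid_simple hA hst hk h,
    braid_simple hA hst.symm hk (by rw [mul_comm, h])]

/-- Alternating words ending in `t` which are shorter than every relation between `s` and `t`
send `α_s` to a nonnegative combination of `α_s` and `α_t`. -/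
lemma alternatingWord_simple_nonneg (hA : IsEGCM A) {s t : Fin n} (hst : s ≠ t) {q : ℕ}
    (hq : ∀ k : ℕ, 2 ≤ k → A s t * A t s = 4 * cos (π / k) ^ 2 → q < k) :
    ∃ x y : ℝ, 0 ≤ x ∧ 0 ≤ y ∧
      wordMap A (alternatingWord s t q) (simple s) = x • simple s + y • simple t := by
  obtain ⟨C, hC, hCA, h0, h1⟩ : ∃ C : ℝ, 0 ≤ C ∧ A s t * A t s = 4 * C ^ 2 ∧
      0 ≤ chebU C q ∧ 0 ≤ chebU C (q + 1) := by
    rcases hA.2.2.2 s t hst with h | ⟨k, hk, h⟩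
    · have hC : 1 ≤ √(A s t * A t s) / 2 := by
        have : (2 : ℝ) ≤ √(A s t * A t s) := le_sqrt_of_sq_le (by linarith)
        linarith
      refine ⟨√(A s t * A t s) / 2, by positivity, ?_, chebU_nonneg_of_one_le hC _,
        chebU_nonneg_of_one_le hC _⟩
      rw [div_pow, sq_sqrt (by linarith)]
      ring
    · exact ⟨_, cos_pi_div_nonneg hk, h, chebU_cos_pi_div_nonneg hk (hq k hk h).le,
        chebU_cos_pi_div_nonneg hk (hq k hk h)⟩
  obtain ⟨ρ, hρ, e1, e2⟩ := exists_scaling hA hst hC hCA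
  rw [wordMap_alternatingWord_simple hA e1 e2]
  split_ifs
  · exact ⟨_, _, h1, mul_nonneg hρ.le h0, rfl⟩
  · exact ⟨_, _, h0, mul_nonneg hρ.le h1, rfl⟩

end RankTwo

section Dichotomy

variable {A : Fin n → Fin n → ℝ}

/-- A factor of a minimal factorization is an alternating word short enough for the rank two
computation. -/
lemma exists_nonneg_of_minimal (hA : IsEGCM A) {s t : Fin n} (hst : s ≠ t)
    {v : Function.End (Fin n → ℝ)} {p : List (Fin n)} (hp : ∀ x ∈ p, x = s ∨ x = t)
    (hmin : ∀ p', v * wordMap A p' = v * wordMap A p → p.length ≤ p'.length)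
    (hmin' : ∀ p', v * wordMap A p' = v * wordMap A p * S A s → p.length ≤ p'.length) :
    ∃ x y : ℝ, 0 ≤ x ∧ 0 ≤ y ∧ wordMap A p (simple s) = x • simple s + y • simple t := by
  have hlast (q : List (Fin n)) : wordMap A p = wordMap A (q ++ [s]) → p.length ≤ q.length := by
    intro h
    refine hmin' q ?_
    rw [h, wordMap_append, wordMap_singleton, mul_assoc, mul_assoc, S_mul_self hA, mul_one]
  have halt : p = alternatingWord s t p.length := by
    refine eq_alternatingWord p s t hp ?_ ?_
    · rintro a b i rfl
      have := hmin (a ++ b) (by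
        rw [wordMap_append, wordMap_append, wordMap_cons, wordMap_cons, ← mul_assoc (S A i),
          S_mul_self hA, one_mul])
      simp at this
    · intro q h
      have := hlast q (by rw [h])
      rw [h] at this
      simp at this
  have hq : ∀ k : ℕ, 2 ≤ k → A s t * A t s = 4 * cos (π / k) ^ 2 → p.length < k := by
    intro k hk h
    by_contra! hle
    obtain ⟨q, hq, e⟩ := exists_append_alternatingWord s t k (p.length - k)
    rw [Nat.sub_add_cancel hle, ← halt] at e
    obtain ⟨m, rfl⟩ : ∃ m, k = m + 1 := ⟨k - 1, by omega⟩
    have := hlast (q ++ alternatingWord s t m) (by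
      rw [e, wordMap_append, braid hA hst hk h, alternatingWord, List.concat_eq_append,
        List.append_assoc, ← wordMap_append])
    rw [List.length_append, CoxeterSystem.length_alternatingWord] at this
    omega
  rw [halt]
  exact alternatingWord_simple_nonneg hA hst hq

lemma apply_simple_nonneg (hA : IsEGCM A) {w : Function.End (Fin n → ℝ)} (hw : w ∈ Wgrp A)
    {s : Fin n} (hs : len A w ≤ len A (w * S A s)) (j : Fin n) : 0 ≤ w (simple s) j := by
  induction hN : len A w using Nat.strong_induction_on generalizing w s with
  | _ N ih =>
  subst hN
  obtain ⟨l, hl, hlen⟩ := exists_reduced hw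
  rcases List.eq_nil_or_concat l with rfl | ⟨l, t, rfl⟩
  · rw [← hl, wordMap_nil, Function.End.one_def]
    by_cases h : j = s <;> simp [simple, h]
  rw [List.concat_eq_append] at hl hlen
  rw [List.length_append, List.length_singleton] at hlen
  have hwt : w = wordMap A l * wordMap A [t] := by rw [← hl, wordMap_append]
  have hst : s ≠ t := by
    rintro rfl
    rw [hwt, wordMap_singleton, mul_assoc, S_mul_self hA, mul_one, ← wordMap_singleton,
      ← wordMap_append, hl] at hs
    have := len_wordMap_le (A := A) l
    omega
  let P : ℕ → Prop := fun d => ∃ v ∈ Wgrp A, ∃ p : List (Fin n), (∀ x ∈ p, x = s ∨ x = t) ∧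
    w = v * wordMap A p ∧ len A v + p.length ≤ len A w ∧ len A v = d
  have hl_len := len_wordMap_le (A := A) l
  have hPl : P (len A (wordMap A l)) :=
    ⟨_, wordMap_mem A l, [t], by simp, hwt, by simp; omega, rfl⟩
  classical
  have hP : ∃ d, P d := ⟨_, hPl⟩
  obtain ⟨v, hv, p, hp, hwv, hvp, hd⟩ := Nat.find_spec hP
  have hvw : len A v < len A w := by
    have := Nat.find_min' hP hPl
    omega
  have hstep (i : Fin n) (hi : i = s ∨ i = t) : len A v ≤ len A (v * S A i) := by
    by_contra! hlt
    refine Nat.find_min hP (hd ▸ hlt) ⟨v * S A i,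
      mul_mem hv (Submonoid.subset_closure ⟨i, rfl⟩), i :: p, ?_, ?_, ?_, rfl⟩
    · simpa [hi] using hp
    · rw [wordMap_cons, mul_assoc, ← mul_assoc (S A i), S_mul_self hA, one_mul, hwv]
    · rw [List.length_cons]
      omega
  obtain ⟨x, y, hx, hy, hxy⟩ := exists_nonneg_of_minimal hA hst (v := v) hp
    (fun p' h => by
      have := len_mul_wordMap_le hv p'
      rw [h, ← hwv] at this
      omega)
    (fun p' h => by
      have := len_mul_wordMap_le hv p'
      rw [h, ← hwv] at this
      omega)
  have hlin := isLinearMap_of_mem hv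
  rw [hwv, end_mul_apply, hxy, hlin.map_add, hlin.map_smul,
    hlin.map_smul]
  exact add_nonneg (mul_nonneg hx (ih _ hvw hv (hstep s (Or.inl rfl)) rfl))
    (mul_nonneg hy (ih _ hvw hv (hstep t (Or.inr rfl)) rfl))

/-- Every root is positive or negative. -/
lemma nonneg_or_nonpos_of_mem_Phi (hA : IsEGCM A) {v : Fin n → ℝ} (hv : v ∈ Phi A) :
    0 ≤ v ∨ v ≤ 0 := by
  obtain ⟨w, hw, i, rfl⟩ := hv
  rcases le_total (len A w) (len A (w * S A i)) with h | h
  · exact Or.inl (apply_simple_nonneg hA hw h)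
  · right
    intro j
    have := apply_simple_nonneg hA (mul_mem hw (Submonoid.subset_closure ⟨i, rfl⟩)) (s := i)
      (by rwa [mul_assoc, S_mul_self hA, mul_one]) j
    rw [end_mul_apply, S_simple_self hA,
      (isLinearMap_of_mem hw).map_neg] at this
    simpa using this

end Dichotomy

section Roots

variable {A : Fin n → Fin n → ℝ}

lemma apply_mem_Phi {w : Function.End (Fin n → ℝ)} (hw : w ∈ Wgrp A) {v : Fin n → ℝ}
    (hv : v ∈ Phi A) : w v ∈ Phi A := by
  obtain ⟨u, hu, i, rfl⟩ := hv
  exact ⟨w * u, mul_mem hw hu, i, rfl⟩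

lemma neg_mem_Phi (hA : IsEGCM A) {v : Fin n → ℝ} (hv : v ∈ Phi A) : -v ∈ Phi A := by
  obtain ⟨u, hu, i, rfl⟩ := hv
  refine ⟨u * S A i, mul_mem hu (Submonoid.subset_closure ⟨i, rfl⟩), i, ?_⟩
  rw [end_mul_apply, S_simple_self hA, (isLinearMap_of_mem hu).map_neg]

lemma ne_zero_of_mem_Phi (hA : IsEGCM A) {v : Fin n → ℝ} (hv : v ∈ Phi A) : v ≠ 0 := by
  obtain ⟨w, hw, i, rfl⟩ := hv
  obtain ⟨w', hw', h⟩ := exists_inverse hA hw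
  intro h0
  have h1 : w' (w (simple i)) = simple i := congrFun h (simple i)
  rw [h0, (isLinearMap_of_mem hw').map_zero] at h1
  simpa [simple] using congrFun h1 i

lemma neg_mem_Phi_iff (hA : IsEGCM A) {v : Fin n → ℝ} : -v ∈ Phi A ↔ v ∈ Phi A :=
  ⟨fun h => by simpa using neg_mem_Phi hA h, neg_mem_Phi hA⟩

lemma Sfrak_neg (α : Fin n → ℝ) : Sfrak A (-α) = Sfrak A α := by
  ext γ
  refine and_congr_right fun _ => ⟨fun ⟨K, h⟩ => ⟨-K, ?_⟩, fun ⟨K, h⟩ => ⟨-K, ?_⟩⟩ <;> simp [h]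

lemma nonempty_equiv_Sfrak_of_nonneg (hA : IsEGCM A) {α : Fin n → ℝ} (hα : α ∈ Phi A)
    (h : 0 ≤ α) : Nonempty ({K : ℝ // 0 < K ∧ K • α ∈ Phi A} ≃ Sfrak A α) := by
  have h0 := ne_zero_of_mem_Phi hA hα
  refine ⟨Equiv.ofBijective (fun K => ⟨K.1 • α, ⟨K.2.2, fun j => mul_nonneg K.2.1.le (h j)⟩,
    K.1, rfl⟩) ⟨fun K K' hK => ?_, ?_⟩⟩
  · exact Subtype.ext (smul_left_injective ℝ h0 (Subtype.ext_iff.1 hK))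
  · rintro ⟨_, ⟨hΦ, hpos⟩, K, rfl⟩
    obtain ⟨j, hj⟩ := Function.ne_iff.1 h0
    have hK : 0 ≤ K := nonneg_of_mul_nonneg_left (hpos j) (lt_of_le_of_ne (h j) hj.symm)
    have hK0 : K ≠ 0 := by
      rintro rfl
      exact ne_zero_of_mem_Phi hA hΦ (zero_smul ℝ α)
    exact ⟨⟨K, lt_of_le_of_ne hK hK0.symm, hΦ⟩, rfl⟩

/-- The positive roots proportional to `α` are parametrized by the positive multipliers which
keep `α` a root. -/
lemma nonempty_equiv_Sfrak (hA : IsEGCM A) {α : Fin n → ℝ} (hα : α ∈ Phi A) :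
    Nonempty ({K : ℝ // 0 < K ∧ K • α ∈ Phi A} ≃ Sfrak A α) := by
  rcases nonneg_or_nonpos_of_mem_Phi hA hα with h | h
  · exact nonempty_equiv_Sfrak_of_nonneg hA hα h
  · simpa only [smul_neg, neg_mem_Phi_iff hA, Sfrak_neg] using
      nonempty_equiv_Sfrak_of_nonneg hA (neg_mem_Phi hA hα) (neg_nonneg.2 h)

end Roots

/-- if roots `α, β ∈ Φ` lie in the same `W`-orbit, then there is a
bijection between `𝔖(α)` and `𝔖(β)`. -/
theorem stmt11 (A : Fin n → Fin n → ℝ) (hA : IsEGCM A)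
    (α β : Fin n → ℝ) (hα : α ∈ Phi A) (hβ : β ∈ Phi A)
    (horb : ∃ w ∈ Wgrp A, w α = β) :
    Nonempty (Sfrak A α ≃ Sfrak A β) := by
  obtain ⟨w, hw, rfl⟩ := horb
  obtain ⟨w', hw', h⟩ := exists_inverse hA hw
  have hiff (K : ℝ) : K • α ∈ Phi A ↔ K • w α ∈ Phi A := by
    rw [← (isLinearMap_of_mem hw).map_smul]
    refine ⟨apply_mem_Phi hw, fun hK => ?_⟩
    have := apply_mem_Phi hw' hK
    rwa [show w' (w (K • α)) = K • α from congrFun h (K • α)] at this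
  obtain ⟨e⟩ := nonempty_equiv_Sfrak hA hα
  obtain ⟨e'⟩ := nonempty_equiv_Sfrak hA hβ
  exact ⟨e.symm.trans ((Equiv.subtypeEquivRight fun K => and_congr_right fun _ => hiff K).trans e')⟩
end

section
/- Let (Γ, A) be an E-GCM graph with finite Coxeter group W, let w₀ be the longest element of W, and let Φ⁺ be the positive roots of its geometric representation. Then N(w₀) = Φ⁺, and with f₁ (resp. f₂) the minimum (resp. maximum) of the finite cardinalities f_{Γ',A'} over ON-connected components, one has f₁·|Φ⁺_std| ≤ |Φ⁺| ≤ f₂·|Φ⁺_std|, where Φ_std is the root system of the standard geometric representation and |Φ⁺_std| = ℓ(w₀). -/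
open Real

variable {n : ℕ}

/-- The matrix of the standard geometric representation attached to the same Coxeter
system: `B_std(α_i, α_j) = -cos(π/m_{ij})` off the diagonal (with value `-2` encoding
`cos(π/∞) = 1` when `m_{ij} = ∞`, i.e. `a_{ij}a_{ji} ≥ 4`). -/
noncomputable def Astd (A : Fin n → Fin n → ℝ) : Fin n → Fin n → ℝ :=
  open scoped Classical in
  fun i j => if i = j then 2
    else if mval A i j = 0 then -2
    else -2 * Real.cos (Real.pi / (mval A i j))

/-- The Coxeter matrix `M` is the matrix of exponents of the E-generalized Cartan matrix `A`. -/
structure IsCompatible (M : CoxeterMatrix (Fin n)) (A : Fin n → Fin n → ℝ) : Prop where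
  diag : ∀ i, A i i = 2
  nonpos : ∀ i j, i ≠ j → A i j ≤ 0
  zero_symm : ∀ i j, A i j = 0 → A j i = 0
  mul_eq : ∀ i j, i ≠ j → M i j ≠ 0 → A i j * A j i = 4 * Real.cos (Real.pi / M i j) ^ 2
  four_le : ∀ i j, i ≠ j → M i j = 0 → 4 ≤ A i j * A j i

/-- The linear form `v ↦ 2B(α_i, v)`. -/
noncomputable def coroot (A : Fin n → Fin n → ℝ) (i : Fin n) : Module.Dual ℝ (Fin n → ℝ) :=
  ∑ j, A i j • LinearMap.proj j

lemma coroot_apply (A : Fin n → Fin n → ℝ) (i : Fin n) (v : Fin n → ℝ) :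
    coroot A i v = ∑ j, A i j * v j := by
  simp [coroot]

lemma coroot_simple (A : Fin n → Fin n → ℝ) (i j : Fin n) : coroot A i (simple j) = A i j := by
  simp [coroot_apply, simple, Pi.single_apply]

/-- Two reflections whose Cartan product is `4cos²(π/m)` generate a dihedral group in which
the `m`-th power of their product is trivial. -/
lemma reflection_mul_reflection_pow_eq_one {V : Type*} [AddCommGroup V] [Module ℝ V]
    {x y : V} {f g : Module.Dual ℝ V} (hf : f x = 2) (hg : g y = 2) {m : ℕ} (hm : 2 ≤ m)
    (hzero : f y = 0 ↔ g x = 0) (hmul : f y * g x = 4 * Real.cos (Real.pi / m) ^ 2) :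
    (Module.reflection hf * Module.reflection hg) ^ m = 1 := by
  have hmpos : (0 : ℝ) < m := by positivity
  ext z
  rw [LinearEquiv.coe_one, id]
  rcases hm.eq_or_lt with rfl | hm
  · have hy : f y = 0 := by
      have : f y * g x = 0 := by rw [hmul]; simp
      rcases mul_eq_zero.mp this with h | h
      · exact h
      · exact hzero.mpr h
    have hx : g x = 0 := hzero.mp hy
    simp only [pow_two, LinearEquiv.mul_apply, Module.reflection_apply, map_sub, map_smul, hf, hg,
      hx, hy]
    module
  rw [Module.reflection_mul_reflection_pow_apply hf hg m z]
  set θ : ℝ := 2 * (Real.pi / m) with hθ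
  have ht : f y * g x - 2 = 2 * Real.cos θ := by
    rw [hmul, hθ, Real.cos_two_mul]; ring
  have hm3 : (3 : ℝ) ≤ m := by exact_mod_cast hm
  have hsin : Real.sin θ ≠ 0 := by
    apply ne_of_gt
    apply Real.sin_pos_of_pos_of_lt_pi
    · positivity
    · rw [hθ, ← mul_div_assoc, div_lt_iff₀ hmpos]
      nlinarith [Real.pi_pos]
  have hmθ : m * θ = 2 * Real.pi := by rw [hθ]; field_simp
  have hS (k : ℤ) := Polynomial.Chebyshev.S_two_mul_real_cos θ k
  rw [ht]
  rcases Nat.even_or_odd' m with ⟨q, rfl | rfl⟩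
  · have h₁ : (((2 * q : ℕ) : ℤ) - 2) / 2 = q - 1 := by omega
    have h₂ : (((2 * q : ℕ) : ℤ) - 1) / 2 = q - 1 := by omega
    have h₀ : (Polynomial.Chebyshev.S ℝ ((q : ℤ) - 1)).eval (2 * Real.cos θ) = 0 := by
      have := hS (q - 1)
      have hq : ((((q : ℤ) - 1 : ℤ) : ℝ) + 1) * θ = Real.pi := by
        push_cast at hmθ ⊢; linarith
      rw [hq, Real.sin_pi] at this
      exact (mul_eq_zero.mp this).resolve_right hsin
    rw [h₁, h₂, h₀]
    simp
  · have h₁ : (((2 * q + 1 : ℕ) : ℤ) - 2) / 2 = q - 1 := by omega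
    have h₂ : (((2 * q + 1 : ℕ) : ℤ) - 1) / 2 = q := by omega
    have h₃ : (((2 * q + 1 : ℕ) : ℤ) - 3) / 2 = q - 1 := by omega
    have h₄ : (((2 * q + 1 : ℕ) : ℤ)) / 2 = q := by omega
    have h₀ : (Polynomial.Chebyshev.S ℝ (q : ℤ)).eval (2 * Real.cos θ) +
        (Polynomial.Chebyshev.S ℝ ((q : ℤ) - 1)).eval (2 * Real.cos θ) = 0 := by
      have h := hS q
      have h' := hS (q - 1)
      have hq : (((q : ℤ) : ℝ) + 1) * θ = 2 * Real.pi - (((q - 1 : ℤ) : ℝ) + 1) * θ := by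
        push_cast at hmθ ⊢; linarith
      rw [hq, Real.sin_two_pi_sub] at h
      have : ((Polynomial.Chebyshev.S ℝ (q : ℤ)).eval (2 * Real.cos θ) +
        (Polynomial.Chebyshev.S ℝ ((q : ℤ) - 1)).eval (2 * Real.cos θ)) * Real.sin θ = 0 := by
        rw [add_mul, h, h']; ring
      exact (mul_eq_zero.mp this).resolve_right hsin
    rw [h₁, h₂, h₃, h₄, h₀]
    simp

/-- The values at `2cos(π/m)` of the first `m` rescaled Chebyshev polynomials are nonnegative. -/
lemma chebyshev_S_nonneg_of_cos {m k : ℕ} (hm : 2 ≤ m) (hk : k ≤ m) :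
    0 ≤ (Polynomial.Chebyshev.S ℝ ((k : ℤ) - 1)).eval (2 * Real.cos (Real.pi / m)) := by
  have hmpos : (0 : ℝ) < m := by positivity
  have hm2 : (2 : ℝ) ≤ m := by exact_mod_cast hm
  have hk' : (k : ℝ) ≤ m := by exact_mod_cast hk
  have h := Polynomial.Chebyshev.S_two_mul_real_cos (Real.pi / m) ((k : ℤ) - 1)
  have hsin : 0 < Real.sin (Real.pi / m) := by
    apply Real.sin_pos_of_pos_of_lt_pi
    · positivity
    · rw [div_lt_iff₀ hmpos]; nlinarith [Real.pi_pos]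
  have hnn : 0 ≤ Real.sin ((((k : ℤ) - 1 : ℤ) + 1 : ℝ) * (Real.pi / m)) := by
    push_cast
    rw [sub_add_cancel]
    apply Real.sin_nonneg_of_nonneg_of_le_pi
    · positivity
    · rw [← mul_div_assoc, div_le_iff₀ hmpos]; nlinarith [Real.pi_pos]
  rw [← h] at hnn
  exact nonneg_of_mul_nonneg_left hnn hsin

lemma chebyshev_S_nonneg_of_two_le {r : ℝ} (hr : 2 ≤ r) (k : ℕ) :
    0 ≤ (Polynomial.Chebyshev.S ℝ ((k : ℤ) - 1)).eval r ∧
    (Polynomial.Chebyshev.S ℝ ((k : ℤ) - 1)).eval r ≤ (Polynomial.Chebyshev.S ℝ k).eval r := by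
  induction k with
  | zero => simp
  | succ k ih =>
    obtain ⟨h₁, h₂⟩ := ih
    push_cast
    rw [add_sub_cancel_right, Polynomial.Chebyshev.S_add_one]
    simp only [Polynomial.eval_sub, Polynomial.eval_mul, Polynomial.eval_X]
    exact ⟨h₁.trans h₂, by nlinarith⟩

namespace IsCompatible

variable {M : CoxeterMatrix (Fin n)} {A : Fin n → Fin n → ℝ}

lemma two_le_of_ne {i j : Fin n} (hij : i ≠ j) (hM : M i j ≠ 0) : 2 ≤ M i j := by
  have := M.off_diagonal i j hij
  omega

lemma coroot_simple_self (h : IsCompatible M A) (i : Fin n) : coroot A i (simple i) = 2 := by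
  rw [coroot_simple, h.diag]

lemma isLiftable (h : IsCompatible M A) :
    M.IsLiftable fun i ↦ Module.reflection (h.coroot_simple_self i) := by
  intro i j
  rcases eq_or_ne i j with rfl | hij
  · rw [M.diagonal, pow_one]
    exact LinearEquiv.ext (Module.involutive_reflection (h.coroot_simple_self i))
  by_cases hM : M i j = 0
  · rw [hM, pow_zero]
  apply reflection_mul_reflection_pow_eq_one _ _ (two_le_of_ne hij hM)
  · simp only [coroot_simple]
    exact ⟨h.zero_symm i j, h.zero_symm j i⟩
  · simp only [coroot_simple]
    exact h.mul_eq i j hij hM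

/-- The geometric representation of the Coxeter group attached to an E-generalized Cartan
matrix. -/
noncomputable def geomRep (h : IsCompatible M A) :
    M.Group →* ((Fin n → ℝ) ≃ₗ[ℝ] (Fin n → ℝ)) :=
  M.toCoxeterSystem.lift ⟨_, h.isLiftable⟩

lemma geomRep_simple (h : IsCompatible M A) (i : Fin n) :
    h.geomRep (M.toCoxeterSystem.simple i) = Module.reflection (h.coroot_simple_self i) :=
  M.toCoxeterSystem.lift_apply_simple h.isLiftable i

lemma geomRep_simple_apply (h : IsCompatible M A) (i : Fin n) (v : Fin n → ℝ) :
    h.geomRep (M.toCoxeterSystem.simple i) v = v - coroot A i v • simple i := by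
  rw [geomRep_simple, Module.reflection_apply]

lemma geomRep_simple_apply_simple (h : IsCompatible M A) (i : Fin n) :
    h.geomRep (M.toCoxeterSystem.simple i) (simple i) = -simple i := by
  rw [geomRep_simple_apply, h.coroot_simple_self]
  module

/-- The symmetrizing constants of a rank two submatrix. -/
lemma exists_scaling (h : IsCompatible M A) {i j : Fin n} (hij : i ≠ j) :
    ∃ c : ℝ, 0 < c ∧ A j i = -(c * √(A i j * A j i)) ∧ c * A i j = -√(A i j * A j i) := by
  have h₁ := h.nonpos i j hij
  have h₂ := h.nonpos j i hij.symm
  by_cases hz : A i j = 0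
  · exact ⟨1, one_pos, by simp [hz, h.zero_symm i j hz]⟩
  have hz' : A j i ≠ 0 := fun hz' ↦ hz (h.zero_symm j i hz')
  have p₁ : 0 < -A i j := by linarith [h₁.lt_of_ne hz]
  have p₂ : 0 < -A j i := by linarith [h₂.lt_of_ne hz']
  have hp : 0 < A i j * A j i := by nlinarith
  have hs : 0 < √(A i j * A j i) := Real.sqrt_pos.mpr hp
  have hsq := Real.mul_self_sqrt hp.le
  generalize √(A i j * A j i) = r at hs hsq ⊢
  refine ⟨-A j i / r, by positivity, by field_simp, ?_⟩
  field_simp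
  linarith

lemma chebyshev_S_sqrt_nonneg (h : IsCompatible M A) {i j : Fin n} (hij : i ≠ j) {k : ℕ}
    (hk : M i j = 0 ∨ k ≤ M i j) :
    0 ≤ (Polynomial.Chebyshev.S ℝ ((k : ℤ) - 1)).eval √(A i j * A j i) := by
  by_cases hM : M i j = 0
  · apply (chebyshev_S_nonneg_of_two_le _ k).1
    apply Real.le_sqrt_of_sq_le
    linarith [h.four_le i j hij hM]
  · have hM2 := two_le_of_ne hij hM
    have hpos : (0 : ℝ) < M i j := by positivity
    have hM2' : (2 : ℝ) ≤ M i j := by exact_mod_cast hM2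
    have hcos : 0 ≤ Real.cos (Real.pi / M i j) := by
      apply Real.cos_nonneg_of_neg_pi_div_two_le_of_le
      · have : 0 ≤ Real.pi / M i j := by positivity
        linarith [Real.pi_pos]
      · gcongr
    have : √(A i j * A j i) = 2 * Real.cos (Real.pi / M i j) := by
      rw [h.mul_eq i j hij hM, show 4 * Real.cos (Real.pi / M i j) ^ 2 =
        (2 * Real.cos (Real.pi / M i j)) ^ 2 by ring, Real.sqrt_sq (by positivity)]
    rw [this]
    exact chebyshev_S_nonneg_of_cos hM2 (hk.resolve_left hM)

/-- A short alternating word ending in `j` sends `α_i` to a nonnegative combination of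
`α_i` and `α_j`. -/
lemma geomRep_alternatingWord (h : IsCompatible M A) {i j : Fin n} (hij : i ≠ j) {k : ℕ}
    (hk : M i j = 0 ∨ k < M i j) :
    ∃ a b : ℝ, 0 ≤ a ∧ 0 ≤ b ∧
      h.geomRep (M.toCoxeterSystem.wordProd (CoxeterSystem.alternatingWord i j k)) (simple i) =
        a • simple i + b • simple j := by
  obtain ⟨c, hc, h₁, h₂⟩ := h.exists_scaling hij
  set r := √(A i j * A j i) with hr
  set u : ℕ → ℝ := fun l ↦ (Polynomial.Chebyshev.S ℝ ((l : ℤ) - 1)).eval r with hu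
  have hu2 (l : ℕ) : u (l + 2) = r * u (l + 1) - u l := by
    have : ((l + 2 : ℕ) : ℤ) - 1 = ((l : ℤ) - 1) + 2 := by push_cast; ring
    simp only [hu, this, Polynomial.Chebyshev.S_add_two]
    simp [show (l : ℤ) - 1 + 1 = l by ring]
  have hformula (l : ℕ) :
      h.geomRep (M.toCoxeterSystem.wordProd (CoxeterSystem.alternatingWord i j l)) (simple i) =
        if Even l then u (l + 1) • simple i + (c * u l) • simple j
        else u l • simple i + (c * u (l + 1)) • simple j := by
    induction l with
    | zero => simp [CoxeterSystem.alternatingWord, hu]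
    | succ l ih =>
      rw [CoxeterSystem.alternatingWord_succ', CoxeterSystem.wordProd_cons, map_mul,
        LinearEquiv.mul_apply, ih]
      by_cases hl : Even l
      · have hl' : ¬ Even (l + 1) := by simpa [parity_simps] using hl
        simp only [hl, hl', if_true, if_false, geomRep_simple_apply, map_add, map_smul,
          coroot_simple, h.diag, hu2]
        rw [h₁]
        module
      · have hl' : Even (l + 1) := by simpa [parity_simps] using hl
        simp only [hl, hl', if_true, if_false, geomRep_simple_apply, map_add, map_smul,
          coroot_simple, h.diag, hu2]
        match_scalars
        · linear_combination -u (l + 1) * h₂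
        · ring
  have hn₁ : 0 ≤ u k := h.chebyshev_S_sqrt_nonneg hij (hk.imp_right le_of_lt)
  have hn₂ : 0 ≤ u (k + 1) := h.chebyshev_S_sqrt_nonneg hij (hk.imp_right Nat.succ_le_of_lt)
  rw [hformula]
  split_ifs
  · exact ⟨_, _, hn₂, by positivity, rfl⟩
  · exact ⟨_, _, hn₁, by positivity, rfl⟩

end IsCompatible

namespace IsCompatible

variable {M : CoxeterMatrix (Fin n)} {A : Fin n → Fin n → ℝ}

/-- If `s_i` is not a right descent of `w`, then `w.α_i` is nonnegative. -/
theorem geomRep_simple_nonneg (h : IsCompatible M A) (w : M.Group) (i : Fin n)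
    (hw : ¬ M.toCoxeterSystem.IsRightDescent w i) : 0 ≤ h.geomRep w (simple i) := by
  set cs := M.toCoxeterSystem
  induction hl : cs.length w using Nat.strong_induction_on generalizing w i with
  | _ N ih =>
  by_cases hw1 : w = 1
  · subst hw1
    simp [simple]
  obtain ⟨j, hj⟩ := cs.exists_rightDescent_of_ne_one hw1
  have hij : i ≠ j := by rintro rfl; exact hw hj
  let P : ℕ → Prop := fun k ↦
    ∃ v, w = v * cs.wordProd (CoxeterSystem.alternatingWord i j k) ∧ cs.length w = cs.length v + k
  have hP1 : P 1 := by
    refine ⟨w * cs.simple j, by simp [CoxeterSystem.alternatingWord], ?_⟩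
    exact (cs.isRightDescent_iff.mp hj).symm
  have hPbound : ∀ k, P k → k ≤ N := by
    rintro k ⟨v, -, hv⟩
    omega
  classical
  obtain ⟨k, hk1, ⟨v, hv, hlen⟩, hmax⟩ : ∃ k, 1 ≤ k ∧ P k ∧ ¬ P (k + 1) := by
    refine ⟨Nat.findGreatest P N, Nat.le_findGreatest (hPbound 1 hP1) hP1,
      Nat.findGreatest_spec (hPbound 1 hP1) hP1, fun hP ↦ ?_⟩
    have := Nat.le_findGreatest (hPbound _ hP) hP
    omega
  obtain ⟨l, rfl⟩ : ∃ l, k = l + 1 := ⟨k - 1, by omega⟩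
  have hfirst : ¬ cs.IsRightDescent v (if Even l then j else i) := by
    intro hd
    rw [cs.isRightDescent_iff] at hd
    rw [CoxeterSystem.alternatingWord_succ', cs.wordProd_cons, ← mul_assoc] at hv
    have h₁ := cs.length_mul_le (v * cs.simple (if Even l then j else i))
      (cs.wordProd (CoxeterSystem.alternatingWord i j l))
    have h₂ := cs.length_wordProd_le (CoxeterSystem.alternatingWord i j l)
    rw [← hv] at h₁
    rw [CoxeterSystem.length_alternatingWord] at h₂
    omega
  have hnext : ¬ cs.IsRightDescent v (if Even (l + 1) then j else i) := by
    intro hd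
    rw [cs.isRightDescent_iff] at hd
    apply hmax
    refine ⟨v * cs.simple (if Even (l + 1) then j else i), ?_, by omega⟩
    rw [CoxeterSystem.alternatingWord_succ', cs.wordProd_cons, ← mul_assoc,
      cs.simple_mul_simple_cancel_right]
    exact hv
  have hvi : ¬ cs.IsRightDescent v i ∧ ¬ cs.IsRightDescent v j := by
    by_cases hl : Even l
    · have hl' : ¬ Even (l + 1) := by simpa [parity_simps] using hl
      rw [if_pos hl] at hfirst
      rw [if_neg hl'] at hnext
      exact ⟨hnext, hfirst⟩
    · have hl' : Even (l + 1) := by simpa [parity_simps] using hl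
      rw [if_neg hl] at hfirst
      rw [if_pos hl'] at hnext
      exact ⟨hfirst, hnext⟩
  have hshort : M i j = 0 ∨ l + 1 < M i j := by
    by_contra! hcon
    have hred := cs.not_isReduced_alternatingWord j i (m := l + 1 + 1)
      (by rw [M.symmetric]; exact hcon.1) (by rw [M.symmetric]; omega)
    have hle := cs.length_wordProd_le (CoxeterSystem.alternatingWord j i (l + 1 + 1))
    have hne : cs.length (cs.wordProd (CoxeterSystem.alternatingWord j i (l + 1 + 1))) ≠
      (CoxeterSystem.alternatingWord j i (l + 1 + 1)).length := hred
    rw [CoxeterSystem.length_alternatingWord] at hle hne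
    have hwi : w * cs.simple i =
        v * cs.wordProd (CoxeterSystem.alternatingWord j i (l + 1 + 1)) := by
      rw [CoxeterSystem.alternatingWord_succ, cs.wordProd_concat, ← mul_assoc, ← hv]
    have h₁ := cs.length_mul_le v
      (cs.wordProd (CoxeterSystem.alternatingWord j i (l + 1 + 1)))
    rw [← hwi, cs.not_isRightDescent_iff.mp hw] at h₁
    omega
  obtain ⟨a, b, ha, hb, hab⟩ := h.geomRep_alternatingWord hij hshort
  have hvlt : cs.length v < N := by omega
  rw [hv, map_mul, LinearEquiv.mul_apply, hab, map_add, map_smul, map_smul]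
  exact add_nonneg (smul_nonneg ha (ih _ hvlt v i hvi.1 rfl))
    (smul_nonneg hb (ih _ hvlt v j hvi.2 rfl))

theorem geomRep_simple_nonpos (h : IsCompatible M A) (w : M.Group) (i : Fin n)
    (hw : M.toCoxeterSystem.IsRightDescent w i) : h.geomRep w (simple i) ≤ 0 := by
  have := h.geomRep_simple_nonneg _ i
    ((M.toCoxeterSystem.isRightDescent_iff_not_isRightDescent_mul).mp hw)
  rwa [map_mul, LinearEquiv.mul_apply, h.geomRep_simple_apply_simple, map_neg,
    Right.nonneg_neg_iff] at this

lemma geomRep_injective (h : IsCompatible M A) : Function.Injective h.geomRep := by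
  rw [injective_iff_map_eq_one]
  intro w hw
  by_contra hne
  obtain ⟨i, hi⟩ := M.toCoxeterSystem.exists_rightDescent_of_ne_one hne
  have := h.geomRep_simple_nonpos w i hi i
  rw [hw] at this
  simp [simple] at this
  linarith

lemma geomRep_nonneg_or_nonpos (h : IsCompatible M A) (w : M.Group) (i : Fin n) :
    0 ≤ h.geomRep w (simple i) ∨ h.geomRep w (simple i) ≤ 0 := by
  by_cases hw : M.toCoxeterSystem.IsRightDescent w i
  · exact .inr (h.geomRep_simple_nonpos w i hw)
  · exact .inl (h.geomRep_simple_nonneg w i hw)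

/-- The geometric representation with values in transformations of `ℝⁿ`. -/
noncomputable def endRep (h : IsCompatible M A) : M.Group →* Function.End (Fin n → ℝ) :=
  (MulAction.toEndHom (M := (Fin n → ℝ) ≃ₗ[ℝ] (Fin n → ℝ))).comp h.geomRep

lemma endRep_apply (h : IsCompatible M A) (w : M.Group) (v : Fin n → ℝ) :
    h.endRep w v = h.geomRep w v := rfl

lemma endRep_simple (h : IsCompatible M A) (i : Fin n) :
    h.endRep (M.toCoxeterSystem.simple i) = S A i := by
  funext v
  rw [endRep_apply, geomRep_simple_apply, coroot_apply]
  rfl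

lemma endRep_injective (h : IsCompatible M A) : Function.Injective h.endRep := by
  intro w w' hww
  apply h.geomRep_injective
  ext1 v
  exact congrFun hww v

lemma mem_Wgrp_iff (h : IsCompatible M A) (f : Function.End (Fin n → ℝ)) :
    f ∈ Wgrp A ↔ ∃ w, h.endRep w = f := by
  have : Set.range (S A) = h.endRep '' Set.range M.toCoxeterSystem.simple := by
    rw [← Set.range_comp]
    congr 1
    funext i
    exact (h.endRep_simple i).symm
  rw [Wgrp, this, ← MonoidHom.map_mclosure, CoxeterSystem.submonoid_closure_range_simple]
  simp

lemma len_endRep (h : IsCompatible M A) (w : M.Group) :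
    len A (h.endRep w) = M.toCoxeterSystem.length w := by
  have hword (l : List (Fin n)) :
      (l.map (S A)).prod = h.endRep (M.toCoxeterSystem.wordProd l) := by
    rw [CoxeterSystem.wordProd, map_list_prod, List.map_map]
    congr 2
    funext i
    exact (h.endRep_simple i).symm
  apply le_antisymm
  · obtain ⟨l, hl, rfl⟩ := M.toCoxeterSystem.exists_isReduced w
    exact Nat.sInf_le ⟨l, hl.eq.symm, hword l⟩
  · refine le_csInf ?_ ?_
    · obtain ⟨l, rfl⟩ := M.toCoxeterSystem.wordProd_surjective w
      exact ⟨_, l, rfl, hword l⟩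
    · rintro _ ⟨l, rfl, hl⟩
      rw [hword] at hl
      rw [← h.endRep_injective hl]
      exact M.toCoxeterSystem.length_wordProd_le l

lemma mem_Phi_iff (h : IsCompatible M A) (v : Fin n → ℝ) :
    v ∈ Phi A ↔ ∃ w i, h.geomRep w (simple i) = v := by
  constructor
  · rintro ⟨f, hf, i, rfl⟩
    obtain ⟨w, rfl⟩ := (h.mem_Wgrp_iff f).mp hf
    exact ⟨w, i, rfl⟩
  · rintro ⟨w, i, rfl⟩
    exact ⟨h.endRep w, (h.mem_Wgrp_iff _).mpr ⟨w, rfl⟩, i, rfl⟩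

lemma geomRep_mem_Phi (h : IsCompatible M A) (w : M.Group) {v : Fin n → ℝ} (hv : v ∈ Phi A) :
    h.geomRep w v ∈ Phi A := by
  obtain ⟨w', i, rfl⟩ := (h.mem_Phi_iff v).mp hv
  exact (h.mem_Phi_iff _).mpr ⟨w * w', i, by rw [map_mul]; rfl⟩

lemma simple_mem_PhiPos (h : IsCompatible M A) (i : Fin n) : simple i ∈ PhiPos A := by
  refine ⟨(h.mem_Phi_iff _).mpr ⟨1, i, by simp⟩, fun j ↦ ?_⟩
  rw [simple, Pi.single_apply]
  split_ifs <;> simp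

lemma nonneg_or_nonpos_of_mem_Phi (h : IsCompatible M A) {v : Fin n → ℝ} (hv : v ∈ Phi A) :
    0 ≤ v ∨ v ≤ 0 := by
  obtain ⟨w, i, rfl⟩ := (h.mem_Phi_iff v).mp hv
  exact h.geomRep_nonneg_or_nonpos w i

lemma ne_zero_of_mem_Phi (h : IsCompatible M A) {v : Fin n → ℝ} (hv : v ∈ Phi A) : v ≠ 0 := by
  obtain ⟨w, i, rfl⟩ := (h.mem_Phi_iff v).mp hv
  rw [Ne, LinearEquiv.map_eq_zero_iff]
  intro h0
  simpa [simple] using congrFun h0 i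

lemma finite_Phi (h : IsCompatible M A) [Finite M.Group] : (Phi A).Finite := by
  refine (Set.finite_range fun p : M.Group × Fin n ↦ h.geomRep p.1 (simple p.2)).subset ?_
  intro v hv
  obtain ⟨w, i, rfl⟩ := (h.mem_Phi_iff v).mp hv
  exact ⟨(w, i), rfl⟩

/-- `s_i` preserves positivity of the roots not proportional to `α_i`. -/
lemma geomRep_simple_mem_PhiPos (h : IsCompatible M A) {i : Fin n} {v : Fin n → ℝ}
    (hv : v ∈ PhiPos A) (hvi : v ∉ Sfrak A (simple i)) :
    h.geomRep (M.toCoxeterSystem.simple i) v ∈ PhiPos A := by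
  have hmem := h.geomRep_mem_Phi (M.toCoxeterSystem.simple i) hv.1
  refine ⟨hmem, ?_⟩
  obtain ⟨j, hji, hj⟩ : ∃ j, j ≠ i ∧ v j ≠ 0 := by
    by_contra! hcon
    refine hvi ⟨hv, v i, ?_⟩
    funext j
    by_cases hji : j = i
    · simp [hji, simple]
    · simp [hcon j hji, simple, hji]
  rcases h.nonneg_or_nonpos_of_mem_Phi hmem with hpos | hneg
  · exact hpos
  · have hle := hneg j
    rw [geomRep_simple_apply] at hle
    simp only [Pi.sub_apply, Pi.smul_apply, simple, Pi.single_apply, hji, if_false, smul_zero,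
      sub_zero, Pi.zero_apply] at hle
    exact absurd (le_antisymm hle (hv.2 j)) hj

/-- If `s_i` is not a right descent of `w`, then `N(ws_i) = s_i N(w) ⊔ 𝔖(α_i)`. -/
lemma Nset_mul_simple (h : IsCompatible M A) {w : M.Group} {i : Fin n}
    (hw : ¬ M.toCoxeterSystem.IsRightDescent w i) :
    Nset A (h.endRep (w * M.toCoxeterSystem.simple i)) =
      h.geomRep (M.toCoxeterSystem.simple i) '' Nset A (h.endRep w) ∪ Sfrak A (simple i) ∧
    Disjoint (h.geomRep (M.toCoxeterSystem.simple i) '' Nset A (h.endRep w))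
      (Sfrak A (simple i)) := by
  set σ := h.geomRep (M.toCoxeterSystem.simple i) with hσ
  have hinv (v) : σ (σ v) = v := by
    rw [hσ, ← LinearEquiv.mul_apply, ← map_mul, CoxeterSystem.simple_mul_simple_self, map_one]
    rfl
  have hσi : σ (simple i) = -simple i := h.geomRep_simple_apply_simple i
  have happ (v) : h.endRep (w * M.toCoxeterSystem.simple i) v = h.geomRep w (σ v) := by
    rw [endRep_apply, map_mul]; rfl
  have hwi := h.geomRep_simple_nonneg w i hw
  have hcoef {K : ℝ} (hK : K • simple i ∈ PhiPos A) : 0 ≤ K := by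
    simpa [simple] using hK.2 i
  have hnot {v} (hv : v ∈ Nset A (h.endRep w)) : v ∉ Sfrak A (simple i) := by
    rintro ⟨hpos, K, rfl⟩
    have hle := hv.2.2
    apply h.ne_zero_of_mem_Phi hv.2.1
    rw [endRep_apply, map_smul] at hle ⊢
    exact le_antisymm hle (smul_nonneg (hcoef hpos) hwi)
  constructor
  · ext v
    constructor
    · intro hv
      by_cases hvi : v ∈ Sfrak A (simple i)
      · exact .inr hvi
      · refine .inl ⟨σ v, ⟨h.geomRep_simple_mem_PhiPos hv.1 hvi, ?_⟩, hinv v⟩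
        rw [endRep_apply, ← happ]
        exact hv.2
    · rintro (⟨u, hu, rfl⟩ | ⟨hv, K, rfl⟩)
      · refine ⟨h.geomRep_simple_mem_PhiPos hu.1 (hnot hu), ?_⟩
        rw [happ, hinv]
        exact hu.2
      · refine ⟨hv, h.geomRep_mem_Phi _ hv.1, ?_⟩
        rw [happ, map_smul, hσi, map_smul, map_neg]
        have : K • -(h.geomRep w) (simple i) ≤ 0 := by
          rw [smul_neg, Left.neg_nonpos_iff]
          exact smul_nonneg (hcoef hv) hwi
        exact this
  · rw [Set.disjoint_left]
    rintro _ ⟨u, hu, rfl⟩ ⟨hv, K, hK⟩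
    refine hnot hu ⟨hu.1, -K, ?_⟩
    rw [← hinv u, hK, map_smul, hσi]
    module

/-- Bounds on the sizes of the sets `𝔖(α_i)` give bounds on `|N(w)|` in terms of `ℓ(w)`. -/
lemma ncard_Nset_bounds (h : IsCompatible M A) [Finite M.Group] {f₁ f₂ : ℕ}
    (hf : ∀ x, f₁ ≤ (Sfrak A (simple x)).ncard ∧ (Sfrak A (simple x)).ncard ≤ f₂)
    (w : M.Group) :
    f₁ * M.toCoxeterSystem.length w ≤ (Nset A (h.endRep w)).ncard ∧
    (Nset A (h.endRep w)).ncard ≤ f₂ * M.toCoxeterSystem.length w := by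
  have hN (f) : (Nset A f).Finite := h.finite_Phi.subset fun v hv ↦ hv.1.1
  have hS (x : Fin n) : (Sfrak A (simple x)).Finite := h.finite_Phi.subset fun v hv ↦ hv.1.1
  induction hl : M.toCoxeterSystem.length w generalizing w with
  | zero =>
    rw [M.toCoxeterSystem.length_eq_zero_iff] at hl
    subst hl
    have : Nset A (h.endRep 1) = ∅ := by
      rw [Set.eq_empty_iff_forall_notMem]
      intro v hv
      have hle := hv.2.2
      rw [map_one] at hle
      exact h.ne_zero_of_mem_Phi hv.1.1 (le_antisymm hle hv.1.2)
    rw [this]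
    simp
  | succ l ih =>
    have hne : w ≠ 1 := by
      rintro rfl
      simp at hl
    obtain ⟨i, hi⟩ := M.toCoxeterSystem.exists_rightDescent_of_ne_one hne
    have hlen := M.toCoxeterSystem.isRightDescent_iff.mp hi
    have hnot := M.toCoxeterSystem.isRightDescent_iff_not_isRightDescent_mul.mp hi
    obtain ⟨hEq, hdisj⟩ := h.Nset_mul_simple hnot
    rw [CoxeterSystem.simple_mul_simple_cancel_right] at hEq
    have hcard : (Nset A (h.endRep w)).ncard =
        (Nset A (h.endRep (w * M.toCoxeterSystem.simple i))).ncard +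
          (Sfrak A (simple i)).ncard := by
      rw [hEq, Set.ncard_union_eq hdisj ((hN _).image _) (hS i),
        Set.ncard_image_of_injective _ (LinearEquiv.injective _)]
    obtain ⟨ih₁, ih₂⟩ := ih (w * M.toCoxeterSystem.simple i) (by omega)
    obtain ⟨hf₁, hf₂⟩ := hf i
    rw [hcard, mul_add_one, mul_add_one]
    exact ⟨add_le_add ih₁ hf₁, add_le_add ih₂ hf₂⟩

/-- An element of maximal length makes every positive root negative. -/
lemma Nset_eq_PhiPos (h : IsCompatible M A) {w : M.Group}
    (hw : ∀ w', M.toCoxeterSystem.length w' ≤ M.toCoxeterSystem.length w) :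
    Nset A (h.endRep w) = PhiPos A := by
  refine Set.Subset.antisymm (fun v hv ↦ hv.1) fun v hv ↦ ⟨hv, h.geomRep_mem_Phi w hv.1, ?_⟩
  have hneg (i : Fin n) : h.geomRep w (simple i) ≤ 0 := by
    apply h.geomRep_simple_nonpos
    exact (hw _).lt_of_ne (M.toCoxeterSystem.length_mul_simple_ne w i)
  have hsum : v = ∑ i, v i • simple i := by
    simpa [simple] using (pi_eq_sum_univ' v)
  have : h.geomRep w v ≤ 0 := by
    rw [hsum, map_sum]
    refine Finset.sum_nonpos fun i _ ↦ ?_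
    rw [map_smul]
    exact smul_nonpos_of_nonneg_of_nonpos (hv.2 i) (hneg i)
  exact this

/-- The quadratic form of a symmetric Cartan matrix takes the value `2` on every root. -/
lemma sum_mul_coroot_of_mem_Phi (h : IsCompatible M A) (hsymm : ∀ i j, A i j = A j i)
    {v : Fin n → ℝ} (hv : v ∈ Phi A) : ∑ i, v i * coroot A i v = 2 := by
  obtain ⟨w, k, rfl⟩ := (h.mem_Phi_iff v).mp hv
  induction w using M.toCoxeterSystem.simple_induction_left with
  | one => simp [h.diag, simple, Pi.single_apply, coroot_apply]
  | mul_simple_left w i ih =>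
    have ih := ih ((h.mem_Phi_iff _).mpr ⟨w, k, rfl⟩)
    rw [map_mul, LinearEquiv.mul_apply, geomRep_simple_apply]
    generalize h.geomRep w (simple k) = u at ih
    have hu : ∑ j, u j * A j i = coroot A i u := by
      rw [coroot_apply]
      exact Finset.sum_congr rfl fun j _ ↦ by rw [hsymm j i, mul_comm]
    have hi (g : Fin n → ℝ) : ∑ j, simple i j * g j = g i := by
      simp [simple, Pi.single_apply]
    calc _ = ∑ j, u j * coroot A j u - coroot A i u * ∑ j, u j * A j i
          - coroot A i u * ∑ j, simple i j * coroot A j u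
          + coroot A i u ^ 2 * ∑ j, simple i j * A j i := by
            simp only [Finset.mul_sum, ← Finset.sum_sub_distrib, ← Finset.sum_add_distrib]
            refine Finset.sum_congr rfl fun j _ ↦ ?_
            simp only [map_sub, map_smul, coroot_simple, Pi.sub_apply, Pi.smul_apply, smul_eq_mul]
            ring
      _ = 2 := by
        rw [hu, hi, hi (fun j ↦ A j i), ih, h.diag]
        ring

lemma ncard_Sfrak_of_symm (h : IsCompatible M A) (hsymm : ∀ i j, A i j = A j i) (i : Fin n) :
    (Sfrak A (simple i)).ncard = 1 := by
  rw [Set.ncard_eq_one]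
  refine ⟨simple i, Set.Subset.antisymm ?_ ?_⟩
  · rintro _ ⟨hv, K, rfl⟩
    have hQ := h.sum_mul_coroot_of_mem_Phi hsymm hv.1
    have hK : 0 ≤ K := by simpa [simple] using hv.2 i
    have : K * (K * 2) = 2 := by
      simpa [coroot_simple, simple, Pi.single_apply, coroot_apply, h.diag] using hQ
    have : K = 1 := by nlinarith
    simp [this]
  · rintro _ rfl
    exact ⟨h.simple_mem_PhiPos i, 1, by simp⟩

end IsCompatible

lemma mval_symm (A : Fin n → Fin n → ℝ) (i j : Fin n) : mval A i j = mval A j i := by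
  unfold mval
  rw [mul_comm (A i j) (A j i)]

lemma mval_spec {A : Fin n → Fin n → ℝ} {i j : Fin n} (h : mval A i j ≠ 0) :
    2 ≤ mval A i j ∧ A i j * A j i = 4 * Real.cos (Real.pi / mval A i j) ^ 2 := by
  unfold mval at h ⊢
  split_ifs with hex
  · exact hex.choose_spec
  · simp [hex] at h

/-- The Coxeter matrix of an E-generalized Cartan matrix. -/
noncomputable def coxeterMatrix (A : Fin n → Fin n → ℝ) : CoxeterMatrix (Fin n) where
  M := fun i j ↦ if i = j then 1 else mval A i j
  isSymm := by
    refine Matrix.IsSymm.ext fun i j ↦ ?_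
    simp only [mval_symm A i j, eq_comm]
  diagonal := by simp
  off_diagonal := by
    intro i j hij
    rw [if_neg hij]
    intro h1
    have := (mval_spec (A := A) (i := i) (j := j) (by omega)).1
    omega

lemma coxeterMatrix_apply_of_ne (A : Fin n → Fin n → ℝ) {i j : Fin n} (hij : i ≠ j) :
    coxeterMatrix A i j = mval A i j :=
  if_neg hij

lemma IsEGCM.isCompatible {A : Fin n → Fin n → ℝ} (hA : IsEGCM A) :
    IsCompatible (coxeterMatrix A) A where
  diag := hA.1
  nonpos := hA.2.1
  zero_symm := hA.2.2.1
  mul_eq := by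
    intro i j hij hM
    rw [coxeterMatrix_apply_of_ne A hij] at hM ⊢
    exact (mval_spec hM).2
  four_le := by
    intro i j hij hM
    rw [coxeterMatrix_apply_of_ne A hij] at hM
    refine (hA.2.2.2 i j hij).resolve_right fun hex ↦ ?_
    rw [mval, dif_pos hex] at hM
    have := hex.choose_spec.1
    omega

lemma Astd_symm (A : Fin n → Fin n → ℝ) (i j : Fin n) : Astd A i j = Astd A j i := by
  simp only [Astd, mval_symm A i j, eq_comm]

lemma Astd_isCompatible (A : Fin n → Fin n → ℝ) :
    IsCompatible (coxeterMatrix A) (Astd A) where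
  diag := by simp [Astd]
  nonpos := by
    intro i j hij
    rw [Astd, if_neg hij]
    split_ifs with hm
    · norm_num
    · have h2 : (2 : ℝ) ≤ mval A i j := by exact_mod_cast (mval_spec hm).1
      have : 0 ≤ Real.cos (Real.pi / mval A i j) := by
        apply Real.cos_nonneg_of_neg_pi_div_two_le_of_le
        · have : 0 ≤ Real.pi / mval A i j := by positivity
          linarith [Real.pi_pos]
        · gcongr
      linarith
  zero_symm := by
    intro i j h
    rw [Astd_symm, h]
  mul_eq := by
    intro i j hij hM
    rw [coxeterMatrix_apply_of_ne A hij] at hM ⊢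
    rw [Astd_symm A j i, Astd, if_neg hij, if_neg hM]
    ring
  four_le := by
    intro i j hij hM
    rw [coxeterMatrix_apply_of_ne A hij] at hM
    rw [Astd_symm A j i, Astd, if_neg hij, if_pos hM]
    norm_num

/-- Corollary 3.11: if `W` is finite with longest element `w₀`, then
`N(w₀) = Φ⁺`, `|Φ⁺_std| = ℓ(w₀)`, and `f₁·|Φ⁺_std| ≤ |Φ⁺| ≤ f₂·|Φ⁺_std|` where `f₁`
(resp. `f₂`) is a min (resp. max) of the finite cardinalities `|𝔖(α_x)|`. -/
theorem stmt18 (A : Fin n → Fin n → ℝ) (hA : IsEGCM A)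
    (hWfin : (Wgrp A : Set (Function.End (Fin n → ℝ))).Finite)
    (w₀ : Function.End (Fin n → ℝ)) (hw₀ : w₀ ∈ Wgrp A)
    (hlong : ∀ w ∈ Wgrp A, len A w ≤ len A w₀)
    (f₁ f₂ : ℕ)
    (hbounds : ∀ x : Fin n, (Sfrak A (simple x)).Finite ∧
      f₁ ≤ (Sfrak A (simple x)).ncard ∧ (Sfrak A (simple x)).ncard ≤ f₂)
    (hf₁ : ∃ x : Fin n, (Sfrak A (simple x)).ncard = f₁)
    (hf₂ : ∃ x : Fin n, (Sfrak A (simple x)).ncard = f₂) :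
    Nset A w₀ = PhiPos A ∧
    (PhiPos (Astd A)).ncard = len A w₀ ∧
    f₁ * (PhiPos (Astd A)).ncard ≤ (PhiPos A).ncard ∧
    (PhiPos A).ncard ≤ f₂ * (PhiPos (Astd A)).ncard := by
  have h := hA.isCompatible
  have hstd := Astd_isCompatible A
  obtain ⟨w, rfl⟩ := (h.mem_Wgrp_iff w₀).mp hw₀
  have : Finite (coxeterMatrix A).Group := by
    have hsub : Set.range h.endRep ⊆ Wgrp A := by
      rintro _ ⟨w', rfl⟩
      exact (h.mem_Wgrp_iff _).mpr ⟨w', rfl⟩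
    exact Set.finite_range_iff h.endRep_injective |>.mp (hWfin.subset hsub)
  have hmax (w') : (coxeterMatrix A).toCoxeterSystem.length w' ≤
      (coxeterMatrix A).toCoxeterSystem.length w := by
    rw [← h.len_endRep, ← h.len_endRep]
    exact hlong _ ((h.mem_Wgrp_iff _).mpr ⟨w', rfl⟩)
  have hN := h.Nset_eq_PhiPos hmax
  have hNstd := hstd.Nset_eq_PhiPos hmax
  have hcard := h.ncard_Nset_bounds (fun x ↦ (hbounds x).2) w
  have hcardStd := hstd.ncard_Nset_bounds (f₁ := 1) (f₂ := 1)
    (fun x ↦ by simp [hstd.ncard_Sfrak_of_symm (Astd_symm A) x]) w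
  rw [hN] at hcard
  rw [hNstd, one_mul] at hcardStd
  have hlen := le_antisymm hcardStd.2 hcardStd.1
  rw [h.len_endRep, hlen]
  exact ⟨hN, rfl, hcard⟩
end
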